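/- Let R = k[s,t] over a field k of characteristic 0, and let p, q, r be positive integers with p + q − r ≥ 2, p + r − q ≥ 2, and q + r − p ≥ 2. Then the ideal I = ⟨s^p, t^q⟩ : (s+t)^r is a complete intersection generated by two relatively prime forms of degrees ⌊(p+q−r)/2⌋ and ⌈(p+q−r)/2⌉. -/

import Mathlib

open MvPolynomial

namespace Stmt8

section
attribute [local instance] MvPolynomial.gradedAlgebra

theorem hc_mul {k : Type} [Field k] {i : ℕ} (n : ℕ) {x y : MvPolynomial (Fin 2) k}
    (hy : y.IsHomogeneous i) :
    homogeneousComponent n (x * y) =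
      if i ≤ n then homogeneousComponent (n - i) x * y else 0 := by
  have := DirectSum.coe_decompose_mul_of_right_mem (homogeneousSubmodule (Fin 2) k) n
    (a := x) (b := y) (i := i) hy
  have key : ∀ (φ : MvPolynomial (Fin 2) k) (j : ℕ),
      (DirectSum.decompose (homogeneousSubmodule (Fin 2) k) φ j : MvPolynomial (Fin 2) k) =
        homogeneousComponent j φ := decomposition.decompose'_apply
  rw [key, key] at this
  exact this

end

theorem isHomogeneous_L (k : Type) [Field k] (r : ℕ) :
    ((X 0 + X 1 : MvPolynomial (Fin 2) k) ^ r).IsHomogeneous r := by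
  simpa using (((isHomogeneous_X k (0 : Fin 2)).add (isHomogeneous_X k (1 : Fin 2))).pow r)

theorem isHomogeneous_Xp (k : Type) [Field k] (i : Fin 2) (r : ℕ) :
    ((X i : MvPolynomial (Fin 2) k) ^ r).IsHomogeneous r := isHomogeneous_X_pow i r

theorem relPrime01 (k : Type) [Field k] : IsRelPrime (X 0 : MvPolynomial (Fin 2) k) (X 1) := by
  rw [(X_prime (R := k) (i := (0 : Fin 2))).irreducible.isRelPrime_iff_not_dvd]
  simp [X_dvd_X]

theorem relPrime0L (k : Type) [Field k] :
    IsRelPrime (X 0 : MvPolynomial (Fin 2) k) (X 0 + X 1) := by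
  rw [(X_prime (R := k) (i := (0 : Fin 2))).irreducible.isRelPrime_iff_not_dvd]
  rw [dvd_add_right (dvd_refl _)]
  simp [X_dvd_X]

theorem relPrime1L (k : Type) [Field k] :
    IsRelPrime (X 1 : MvPolynomial (Fin 2) k) (X 0 + X 1) := by
  rw [(X_prime (R := k) (i := (1 : Fin 2))).irreducible.isRelPrime_iff_not_dvd]
  rw [dvd_add_left (dvd_refl _)]
  simp [X_dvd_X]

theorem finMult {k : Type} [Field k] (i : Fin 2) {f : MvPolynomial (Fin 2) k} (hf : f ≠ 0) :
    FiniteMultiplicity (X i) f :=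
  FiniteMultiplicity.of_prime_left X_prime hf

theorem X_mul_D {k : Type} [Field k] (i : Fin 2) (m : ℕ) (f : MvPolynomial (Fin 2) k) :
    X i * pderiv i (X i ^ m * f) = X i ^ m * ((m : MvPolynomial (Fin 2) k) * f + X i * pderiv i f) := by
  rcases m with _ | m
  · simp
  · simp only [Derivation.leibniz, Derivation.leibniz_pow, smul_eq_mul, nsmul_eq_mul,
      pderiv_X_self, Nat.add_sub_cancel]
    ring

/-- If the logarithmic derivatives agree then `f` and `g` have the same valuation. -/
theorem val_lemma {k : Type} [Field k] [CharZero k] (i : Fin 2) (q : ℕ)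
    {f g : MvPolynomial (Fin 2) k} (hf : f ≠ 0) (hg : g ≠ 0) (hq : X i ^ q ∣ g)
    (h : f * pderiv i g = g * pderiv i f) : X i ^ q ∣ f := by
  obtain ⟨f', hf1, hf2⟩ := (finMult i hf).exists_eq_pow_mul_and_not_dvd
  obtain ⟨g', hg1, hg2⟩ := (finMult i hg).exists_eq_pow_mul_and_not_dvd
  have hqn := (finMult i hg).le_multiplicity_of_pow_dvd hq
  set m := multiplicity (X i) f
  set n := multiplicity (X i) g
  have key : (X i : MvPolynomial (Fin 2) k) ^ (m + n) * (((n : MvPolynomial (Fin 2) k) - (m : MvPolynomial (Fin 2) k)) * (f' * g') +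
      X i * (f' * pderiv i g' - g' * pderiv i f')) = 0 := by
    have h1 := X_mul_D i m f'
    have h2 := X_mul_D i n g'
    rw [← hf1] at h1
    rw [← hg1] at h2
    have : X i ^ m * f' * (X i * pderiv i g) = X i ^ n * g' * (X i * pderiv i f) := by
      rw [← hf1, ← hg1]; linear_combination X i * h
    rw [h1, h2] at this
    rw [pow_add]
    linear_combination this
  have k2 := (mul_eq_zero.1 key).resolve_left (pow_ne_zero _ (X_ne_zero i))
  have hmn : m = n := by
    by_contra hne
    have hd : X i ∣ ((n : MvPolynomial (Fin 2) k) - (m : MvPolynomial (Fin 2) k)) * (f' * g') :=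
      ⟨-(f' * pderiv i g' - g' * pderiv i f'), by linear_combination k2⟩
    have hu : IsUnit ((n : MvPolynomial (Fin 2) k) - (m : MvPolynomial (Fin 2) k)) := by
      have : ((n : MvPolynomial (Fin 2) k) - (m : MvPolynomial (Fin 2) k)) = C ((n : k) - m) := by simp
      rw [this]
      apply IsUnit.map
      rw [isUnit_iff_ne_zero, sub_ne_zero]
      intro hnm
      exact hne (Nat.cast_injective hnm).symm
    have hd := (hu.dvd_mul_left).1 hd
    rcases (X_prime (R := k) (i := i)).dvd_or_dvd hd with h | h
    · exact hf2 h
    · exact hg2 h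
  rw [hf1]
  exact Dvd.dvd.mul_right (pow_dvd_pow _ (hmn ▸ hqn)) _

theorem dvd_pderiv {k : Type} [Field k] (i : Fin 2) (p : ℕ) {u f : MvPolynomial (Fin 2) k}
    (h : u ^ p ∣ f) : u ^ (p - 1) ∣ pderiv i f := by
  obtain ⟨g, rfl⟩ := h
  simp only [Derivation.leibniz, Derivation.leibniz_pow, smul_eq_mul, nsmul_eq_mul]
  refine dvd_add (Dvd.dvd.mul_right (pow_dvd_pow _ (by omega)) _) ?_
  exact ⟨g * (p * pderiv i u), by ring⟩

theorem degree_le_of_dvd {k : Type} [Field k] {u f : MvPolynomial (Fin 2) k} {m n : ℕ}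
    (hu : u.IsHomogeneous m) (hf : f.IsHomogeneous n) (hf0 : f ≠ 0) (h : u ∣ f) : m ≤ n := by
  obtain ⟨g, rfl⟩ := h
  rw [← hf.totalDegree hf0]
  have := left_ne_zero_of_mul hf0
  have hg := right_ne_zero_of_mul hf0
  rw [totalDegree_mul_of_isDomain this hg, hu.totalDegree this]
  omega

/-- Lower bound: forms in the colon ideal of small degree vanish. -/
theorem lower {k : Type} [Field k] [CharZero k] (p q r d : ℕ)
    (hp : 0 < p) (hq : 0 < q) (hr : 0 < r)
    (h1 : r + 2 ≤ p + q) (h2 : q + 2 ≤ p + r) (h3 : p + 2 ≤ q + r)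
    (hd : 2 * d + 2 + r ≤ p + q) {h f g : MvPolynomial (Fin 2) k}
    (hh : h.IsHomogeneous d) (hf : f.IsHomogeneous (d + r)) (hg : g.IsHomogeneous (d + r))
    (pf : X 0 ^ p ∣ f) (qg : X 1 ^ q ∣ g) (e : h * (X 0 + X 1) ^ r = f + g) : h = 0 := by
  by_contra h0
  have hL : (X 0 + X 1 : MvPolynomial (Fin 2) k) ^ r ∣ f + g := ⟨h, by rw [← e, mul_comm]⟩
  have hf0 : f ≠ 0 := by
    rintro rfl
    rw [zero_add] at e
    rw [← e] at qg
    have := ((relPrime1L k).pow (m := q) (n := r)).dvd_of_dvd_mul_right qg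
    have := degree_le_of_dvd (isHomogeneous_Xp k 1 q) hh h0 this
    omega
  have hg0 : g ≠ 0 := by
    rintro rfl
    rw [add_zero] at e
    rw [← e] at pf
    have := ((relPrime0L k).pow (m := p) (n := r)).dvd_of_dvd_mul_right pf
    have := degree_le_of_dvd (isHomogeneous_Xp k 0 p) hh h0 this
    omega
  have hW : pderiv 0 f * pderiv 1 g - pderiv 1 f * pderiv 0 g = 0 := by
    by_contra hW0
    have w0 : X 0 ^ (p - 1) ∣ pderiv 0 f * pderiv 1 g - pderiv 1 f * pderiv 0 g :=
      dvd_sub (Dvd.dvd.mul_right (dvd_pderiv _ _ pf) _) (Dvd.dvd.mul_right (dvd_pderiv _ _ pf) _)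
    have w1 : X 1 ^ (q - 1) ∣ pderiv 0 f * pderiv 1 g - pderiv 1 f * pderiv 0 g :=
      dvd_sub (Dvd.dvd.mul_left (dvd_pderiv _ _ qg) _) (Dvd.dvd.mul_left (dvd_pderiv _ _ qg) _)
    have w2 : (X 0 + X 1) ^ (r - 1) ∣ pderiv 0 f * pderiv 1 g - pderiv 1 f * pderiv 0 g := by
      have : pderiv 0 f * pderiv 1 g - pderiv 1 f * pderiv 0 g =
        pderiv 0 (f + g) * pderiv 1 g - pderiv 1 (f + g) * pderiv 0 g := by
        rw [map_add, map_add]; ring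
      rw [this]
      exact dvd_sub (Dvd.dvd.mul_right (dvd_pderiv _ _ hL) _)
        (Dvd.dvd.mul_right (dvd_pderiv _ _ hL) _)
    have w01 := ((relPrime01 k).pow (m := p - 1) (n := q - 1)).mul_dvd w0 w1
    have w := (IsRelPrime.mul_left ((relPrime0L k).pow (m := p - 1) (n := r - 1))
      ((relPrime1L k).pow (m := q - 1) (n := r - 1))).mul_dvd w01 w2
    have hWh : (pderiv 0 f * pderiv 1 g - pderiv 1 f * pderiv 0 g).IsHomogeneous
      ((d + r - 1) + (d + r - 1)) := (hf.pderiv.mul hg.pderiv).sub (hf.pderiv.mul hg.pderiv)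
    have := degree_le_of_dvd (((isHomogeneous_Xp k 0 (p - 1)).mul (isHomogeneous_Xp k 1 (q - 1))).mul
      (isHomogeneous_L k (r - 1))) hWh hW0 w
    omega
  have ef := hf.sum_X_mul_pderiv
  have eg := hg.sum_X_mul_pderiv
  simp only [Fin.sum_univ_two, nsmul_eq_mul] at ef eg
  have hn : ((d + r : ℕ) : MvPolynomial (Fin 2) k) ≠ 0 := by
    exact_mod_cast (show d + r ≠ 0 by omega)
  have e1 : f * pderiv 1 g = g * pderiv 1 f := by
    apply mul_left_cancel₀ hn
    rw [← mul_assoc, ← mul_assoc, ← ef, ← eg]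
    linear_combination X 0 * hW
  have tf := val_lemma 1 q hf0 hg0 qg e1
  have hst := ((relPrime01 k).pow (m := p) (n := q)).mul_dvd pf tf
  have := degree_le_of_dvd ((isHomogeneous_Xp k 0 p).mul (isHomogeneous_Xp k 1 q)) hf hf0 hst
  omega

/-- Taking components of a relation. -/
theorem comp_rel {k : Type} [Field k] (p q r d : ℕ) {h A B : MvPolynomial (Fin 2) k}
    (e : h * (X 0 + X 1) ^ r = A * X 0 ^ p + B * X 1 ^ q) :
    homogeneousComponent d h * (X 0 + X 1) ^ r =
      (if p ≤ d + r then homogeneousComponent (d + r - p) A * X 0 ^ p else 0) +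
      (if q ≤ d + r then homogeneousComponent (d + r - q) B * X 1 ^ q else 0) := by
  have := congrArg (homogeneousComponent (d + r)) e
  rw [map_add, hc_mul _ (isHomogeneous_L k r), hc_mul _ (isHomogeneous_Xp k 0 p),
    hc_mul _ (isHomogeneous_Xp k 1 q)] at this
  simpa using this

theorem lower' {k : Type} [Field k] [CharZero k] (p q r : ℕ)
    (hp : 0 < p) (hq : 0 < q) (hr : 0 < r)
    (h1 : r + 2 ≤ p + q) (h2 : q + 2 ≤ p + r) (h3 : p + 2 ≤ q + r)
    {h A B : MvPolynomial (Fin 2) k} (h0 : h ≠ 0)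
    (e : h * (X 0 + X 1) ^ r = A * X 0 ^ p + B * X 1 ^ q) :
    (p + q - r) / 2 ≤ h.totalDegree := by
  by_contra hlt
  have hc := comp_rel p q r h.totalDegree e
  have hz : homogeneousComponent h.totalDegree h = 0 := by
    refine lower p q r h.totalDegree hp hq hr h1 h2 h3 (by omega)
      (homogeneousComponent_isHomogeneous _ _) ?_ ?_ ?_ ?_ hc
    · split_ifs with hle
      · have := (homogeneousComponent_isHomogeneous (h.totalDegree + r - p) A).mul
          (isHomogeneous_Xp k 0 p)
        rwa [Nat.sub_add_cancel hle] at this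
      · exact isHomogeneous_zero _ _ _
    · split_ifs with hle
      · have := (homogeneousComponent_isHomogeneous (h.totalDegree + r - q) B).mul
          (isHomogeneous_Xp k 1 q)
        rwa [Nat.sub_add_cancel hle] at this
      · exact isHomogeneous_zero _ _ _
    · split_ifs
      · exact dvd_mul_left _ _
      · exact dvd_zero _
    · split_ifs
      · exact dvd_mul_left _ _
      · exact dvd_zero _
  obtain ⟨s, hs, hs'⟩ := Finset.exists_mem_eq_sup h.support (support_nonempty.2 h0)
    (fun s => s.sum fun _ e => e)
  have := congrArg (coeff s) hz
  rw [coeff_homogeneousComponent, if_pos, coeff_zero] at this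
  · exact (mem_support_iff.1 hs) this
  · exact hs'.symm

/-- The exponent `(i, j)`. -/
noncomputable def mm (i j : ℕ) : Fin 2 →₀ ℕ := Finsupp.single 0 i + Finsupp.single 1 j

theorem mm_zero (i j : ℕ) : mm i j 0 = i := by simp [mm]

theorem mm_one (i j : ℕ) : mm i j 1 = j := by simp [mm]

theorem mm_self (d : Fin 2 →₀ ℕ) : mm (d 0) (d 1) = d := by
  ext i; fin_cases i
  · exact mm_zero _ _
  · exact mm_one _ _

theorem degree_eq (d : Fin 2 →₀ ℕ) : d.degree = d 0 + d 1 := by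
  rw [Finsupp.degree_eq_sum, Fin.sum_univ_two]

/-- Binary forms from coefficient vectors. -/
noncomputable def phi (k : Type) [Field k] (n : ℕ) : (Fin (n + 1) → k) →ₗ[k] MvPolynomial (Fin 2) k :=
  Fintype.linearCombination k (fun i : Fin (n + 1) => monomial (mm i (n - i)) (1 : k))

theorem phi_apply {k : Type} [Field k] (n : ℕ) (c : Fin (n + 1) → k) :
    phi k n c = ∑ i : Fin (n + 1), monomial (mm i (n - i)) (c i) := by
  simp [phi, Fintype.linearCombination_apply, smul_monomial]

theorem phi_hom {k : Type} [Field k] (n : ℕ) (c : Fin (n + 1) → k) :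
    (phi k n c).IsHomogeneous n := by
  rw [phi_apply]
  refine IsHomogeneous.sum _ _ _ fun i _ => isHomogeneous_monomial _ ?_
  rw [degree_eq, mm_zero, mm_one]
  have := i.2
  omega

theorem phi_coeff {k : Type} [Field k] (n : ℕ) (c : Fin (n + 1) → k) (i : Fin (n + 1)) :
    coeff (mm i (n - i)) (phi k n c) = c i := by
  rw [phi_apply, coeff_sum, Finset.sum_eq_single i]
  · simp
  · intro j _ hj
    rw [coeff_monomial, if_neg]
    intro h
    apply hj
    have := DFunLike.congr_fun h 0
    rw [mm_zero, mm_zero] at this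
    exact Fin.ext this
  · simp

theorem phi_inj (k : Type) [Field k] (n : ℕ) : Function.Injective (phi k n) := by
  intro c c' h
  ext i
  rw [← phi_coeff n c i, h, phi_coeff]

theorem phi_surj {k : Type} [Field k] (n : ℕ) {f : MvPolynomial (Fin 2) k}
    (hf : f.IsHomogeneous n) : ∃ c, phi k n c = f := by
  refine ⟨fun i => coeff (mm i (n - i)) f, ?_⟩
  ext d
  by_cases hd : d.degree = n
  · rw [degree_eq] at hd
    have := phi_coeff n (fun i : Fin (n + 1) => coeff (mm i (n - i)) f) ⟨d 0, by omega⟩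
    have h2 : mm (d 0) (n - d 0) = d := by
      rw [show n - d 0 = d 1 by omega, mm_self]
    simp only [h2] at this
    exact this
  · rw [hf.coeff_eq_zero hd, (phi_hom n _).coeff_eq_zero hd]

theorem mem_of_coeff {k : Type} [Field k] (p q n : ℕ) {f : MvPolynomial (Fin 2) k}
    (hf : f.IsHomogeneous n)
    (h : ∀ i j, i < p → j < q → i + j = n → coeff (mm i j) f = 0) :
    f ∈ Ideal.span {(X 0 : MvPolynomial (Fin 2) k) ^ p, X 1 ^ q} := by
  have : ({(X 0 : MvPolynomial (Fin 2) k) ^ p, X 1 ^ q} : Set (MvPolynomial (Fin 2) k)) =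
      (fun s => monomial s (1 : k)) '' {Finsupp.single 0 p, Finsupp.single 1 q} := by
    rw [Set.image_pair, X_pow_eq_monomial, X_pow_eq_monomial]
  rw [this, mem_ideal_span_monomial_image]
  intro d hd
  have hdn : d 0 + d 1 = n := by
    by_contra hne
    rw [← degree_eq] at hne
    exact (mem_support_iff.1 hd) (hf.coeff_eq_zero hne)
  by_cases h0 : p ≤ d 0
  · exact ⟨_, by simp, Finsupp.single_le_iff.2 h0⟩
  by_cases h1 : q ≤ d 1
  · exact ⟨_, Or.inr rfl, Finsupp.single_le_iff.2 h1⟩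
  exact absurd (by simpa [mm_self] using h (d 0) (d 1) (by omega) (by omega) hdn)
    (mem_support_iff.1 hd)

/-- The linear conditions for a form of degree `n` to be in the colon ideal. -/
noncomputable def TT (k : Type) [Field k] (p q r n : ℕ) :
    (Fin (n + 1) → k) →ₗ[k] (Fin (p + q - r - n - 1) → k) :=
  LinearMap.pi fun j => (lcoeff k (mm (n + r + 1 - q + j) (q - 1 - j))).comp
    ((LinearMap.mulRight k ((X 0 + X 1 : MvPolynomial (Fin 2) k) ^ r)).comp (phi k n))

theorem TT_mem {k : Type} [Field k] (p q r n : ℕ) (hn : q ≤ n + r + 1) 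
    {c : Fin (n + 1) → k} (hc : TT k p q r n c = 0) :
    phi k n c * (X 0 + X 1) ^ r ∈ Ideal.span {(X 0 : MvPolynomial (Fin 2) k) ^ p, X 1 ^ q} := by
  refine mem_of_coeff p q (n + r) ((phi_hom n c).mul (isHomogeneous_L k r)) ?_
  intro i j hi hj hij
  have := congrFun hc ⟨i - (n + r + 1 - q), by omega⟩
  simp only [TT, LinearMap.pi_apply, LinearMap.comp_apply, LinearMap.mulRight_apply,
    lcoeff_apply, Pi.zero_apply] at this
  rw [show n + r + 1 - q + (i - (n + r + 1 - q)) = i by omega,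
    show q - 1 - (i - (n + r + 1 - q)) = j by omega] at this
  exact this

theorem exists_C {k : Type} [Field k] (p q r n : ℕ) (hn : q ≤ n + r + 1)
    (h : p + q < 2 * n + 2 + r) :
    ∃ C : MvPolynomial (Fin 2) k, C ≠ 0 ∧ C.IsHomogeneous n ∧
      C * (X 0 + X 1) ^ r ∈ Ideal.span {(X 0 : MvPolynomial (Fin 2) k) ^ p, X 1 ^ q} := by
  have := LinearMap.ker_ne_bot_of_finrank_lt (f := TT k p q r n) (by simp; omega)
  obtain ⟨c, hc, hc0⟩ := Submodule.exists_mem_ne_zero_of_ne_bot this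
  refine ⟨phi k n c, ?_, phi_hom n c, TT_mem p q r n hn hc⟩
  intro h0
  exact hc0 (phi_inj k n (by rw [h0, map_zero]))

theorem exists_F {k : Type} [Field k] (p q r a b : ℕ) (hn : q ≤ b + r + 1) (hab : a ≤ b)
    (h : p + q = a + b + r) (ha : 1 ≤ a) {C : MvPolynomial (Fin 2) k} (hC : C.IsHomogeneous a) :
    ∃ F : MvPolynomial (Fin 2) k, ¬ C ∣ F ∧ F.IsHomogeneous b ∧
      F * (X 0 + X 1) ^ r ∈ Ideal.span {(X 0 : MvPolynomial (Fin 2) k) ^ p, X 1 ^ q} := by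
  by_contra hno
  push Not at hno
  let S : (Fin (b - a + 1) → k) →ₗ[k] MvPolynomial (Fin 2) k :=
    (LinearMap.mulRight k C).comp (phi k (b - a))
  have hle : (LinearMap.ker (TT k p q r b)).map (phi k b) ≤ LinearMap.range S := by
    rintro _ ⟨c, hc, rfl⟩
    have hd : C ∣ phi k b c := by
      by_contra hd
      exact hno _ hd (phi_hom b c) (TT_mem p q r b hn hc)
    obtain ⟨v, hv⟩ := hd
    have h1 := congrArg (homogeneousComponent b) hv
    rw [mul_comm, hc_mul _ hC, if_pos hab, homogeneousComponent_eq_self (phi_hom b c)] at h1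
    obtain ⟨w, hw⟩ := phi_surj (b - a) (homogeneousComponent_isHomogeneous (b - a) v)
    exact ⟨w, by simp [S, hw, h1]⟩
  have f1 := Submodule.finrank_mono hle
  rw [← (Submodule.equivMapOfInjective _ (phi_inj k b) _).finrank_eq] at f1
  have f2 := LinearMap.finrank_range_le S
  have f3 := LinearMap.finrank_range_add_finrank_ker (TT k p q r b)
  have f4 := Submodule.finrank_le (LinearMap.range (TT k p q r b))
  simp only [Module.finrank_fintype_fun_eq_card, Fintype.card_fin] at f2 f3 f4
  omega

/-- Homogeneous syzygies. -/
theorem hom_rel {k : Type} [Field k] (p q r d : ℕ) (hp : p ≤ d + r) (hq : q ≤ d + r)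
    {h : MvPolynomial (Fin 2) k} (hh : h.IsHomogeneous d)
    (hm : h * (X 0 + X 1) ^ r ∈ Ideal.span {(X 0 : MvPolynomial (Fin 2) k) ^ p, X 1 ^ q}) :
    ∃ A B : MvPolynomial (Fin 2) k, A.IsHomogeneous (d + r - p) ∧ B.IsHomogeneous (d + r - q) ∧
      h * (X 0 + X 1) ^ r = A * X 0 ^ p + B * X 1 ^ q := by
  obtain ⟨A, B, e⟩ := Ideal.mem_span_pair.1 hm
  have := comp_rel p q r d e.symm
  rw [if_pos hp, if_pos hq, homogeneousComponent_eq_self hh] at this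
  exact ⟨_, _, homogeneousComponent_isHomogeneous _ _, homogeneousComponent_isHomogeneous _ _, this⟩

theorem L_ne (k : Type) [Field k] (r : ℕ) : (X 0 + X 1 : MvPolynomial (Fin 2) k) ^ r ≠ 0 := by
  refine pow_ne_zero _ fun h0 => ?_
  have := relPrime0L k
  rw [h0, isRelPrime_zero_right] at this
  exact X_prime.not_isUnit this

/-- Cross product of two syzygies is a multiple of the vector of generators. -/
theorem cross {k : Type} [Field k] (p q r : ℕ) {h1 A1 B1 h2 A2 B2 : MvPolynomial (Fin 2) k}
    (e1 : h1 * (X 0 + X 1) ^ r = A1 * X 0 ^ p + B1 * X 1 ^ q)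
    (e2 : h2 * (X 0 + X 1) ^ r = A2 * X 0 ^ p + B2 * X 1 ^ q) :
    ∃ κ, A1 * B2 - A2 * B1 = κ * (X 0 + X 1) ^ r ∧ B2 * h1 - B1 * h2 = κ * X 0 ^ p ∧
      A1 * h2 - A2 * h1 = κ * X 1 ^ q := by
  have k0 : X 0 ^ p * (A1 * B2 - A2 * B1) = (X 0 + X 1) ^ r * (B2 * h1 - B1 * h2) := by
    linear_combination B1 * e2 - B2 * e1
  have k1 : X 1 ^ q * (A1 * B2 - A2 * B1) = (X 0 + X 1) ^ r * (A1 * h2 - A2 * h1) := by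
    linear_combination A2 * e1 - A1 * e2
  have hd : (X 0 + X 1) ^ r ∣ A1 * B2 - A2 * B1 :=
    ((relPrime0L k).pow (m := p) (n := r)).symm.dvd_of_dvd_mul_left ⟨_, k0⟩
  obtain ⟨κ, hκ⟩ := hd
  have hL := L_ne k r
  refine ⟨κ, by rw [hκ, mul_comm], ?_, ?_⟩
  · apply mul_left_cancel₀ hL
    rw [← k0, hκ]; ring
  · apply mul_left_cancel₀ hL
    rw [← k1, hκ]; ring

end Stmt8

/-- In `R = k[s,t]` (char 0), if `p + q − r ≥ 2`, `p + r − q ≥ 2` and `q + r − p ≥ 2`, then the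
colon ideal `I = ⟨s^p, t^q⟩ : (s+t)^r` is a complete intersection generated by two relatively
prime forms of degrees `⌊(p+q−r)/2⌋` and `⌈(p+q−r)/2⌉`. -/
theorem stmt_8 (k : Type) [Field k] [CharZero k] (p q r : ℕ)
    (hp : 0 < p) (hq : 0 < q) (hr : 0 < r)
    (h1 : r + 2 ≤ p + q) (h2 : q + 2 ≤ p + r) (h3 : p + 2 ≤ q + r) :
    ∃ C F : MvPolynomial (Fin 2) k,
      C.IsHomogeneous ((p + q - r) / 2) ∧ F.IsHomogeneous ((p + q - r + 1) / 2) ∧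
      C ≠ 0 ∧ F ≠ 0 ∧ IsRelPrime C F ∧
      (Ideal.span {(X 0 : MvPolynomial (Fin 2) k) ^ p, X 1 ^ q}).colon
          (Ideal.span {(X 0 + X 1 : MvPolynomial (Fin 2) k) ^ r}) =
        Ideal.span {C, F} := by
  have low := @Stmt8.lower' k _ _ p q r hp hq hr h1 h2 h3
  obtain ⟨a, ha⟩ : ∃ a, a = (p + q - r) / 2 := ⟨_, rfl⟩
  obtain ⟨b, hb⟩ : ∃ b, b = (p + q - r + 1) / 2 := ⟨_, rfl⟩
  rw [← ha] at low
  rw [← ha, ← hb]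
  obtain ⟨c, hc0, hch, hcm⟩ := Stmt8.exists_C (k := k) p q r a (by omega) (by omega)
  obtain ⟨f, hcf, hfh, hfm⟩ := Stmt8.exists_F p q r a b (by omega) (by omega) (by omega)
    (by omega) hch
  have hf0 : f ≠ 0 := fun h => hcf (h ▸ dvd_zero c)
  obtain ⟨A1, B1, hA1, hB1, e1⟩ := Stmt8.hom_rel p q r a (by omega) (by omega) hch hcm
  obtain ⟨A2, B2, hA2, hB2, e2⟩ := Stmt8.hom_rel p q r b (by omega) (by omega) hfh hfm
  obtain ⟨κ, k1, k2, k3⟩ := Stmt8.cross p q r e1 e2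
  -- the constant is nonzero
  have hκ0 : κ ≠ 0 := by
    rintro rfl
    rw [zero_mul] at k2 k3
    obtain ⟨u1, u2, g, hrel, hg1, hg2⟩ := UniqueFactorizationMonoid.exists_reduced_factors c hc0 f
    have hg0 : g ≠ 0 := by rintro rfl; exact hc0 (by simpa using hg1.symm)
    have hu0 : u1 ≠ 0 := by rintro rfl; exact hc0 (by simpa using hg1.symm)
    have hB : u1 ∣ B1 := by
      refine hrel.dvd_of_dvd_mul_left (z := B1) ⟨B2, ?_⟩
      apply mul_left_cancel₀ hg0
      rw [← hg1, ← hg2] at k2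
      linear_combination -k2
    have hA : u1 ∣ A1 := by
      refine hrel.dvd_of_dvd_mul_left (z := A1) ⟨A2, ?_⟩
      apply mul_left_cancel₀ hg0
      rw [← hg1, ← hg2] at k3
      linear_combination k3
    obtain ⟨A', rfl⟩ := hA
    obtain ⟨B', rfl⟩ := hB
    have e' : g * (X 0 + X 1) ^ r = A' * X 0 ^ p + B' * X 1 ^ q := by
      apply mul_left_cancel₀ hu0
      rw [← hg1] at e1
      linear_combination e1
    have hlow := low hg0 e'
    have hdeg := hch.totalDegree hc0
    rw [← hg1, totalDegree_mul_of_isDomain hg0 hu0] at hdeg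
    have hz : u1.totalDegree = 0 := by omega
    rw [totalDegree_eq_zero_iff_eq_C] at hz
    have hu : IsUnit u1 := by
      rw [hz]
      apply IsUnit.map
      rw [isUnit_iff_ne_zero]
      intro h0
      rw [h0, map_zero] at hz
      exact hu0 hz
    apply hcf
    rw [← hg1, ← hg2]
    exact mul_dvd_mul_left g hu.dvd
  have hL := Stmt8.L_ne k r
  have hκu : IsUnit κ := by
    have hh : (A1 * B2 - A2 * B1).IsHomogeneous r := by
      have t1 := hA1.mul hB2
      have t2 := hA2.mul hB1
      rw [show a + r - p + (b + r - q) = r by omega] at t1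
      rw [show b + r - p + (a + r - q) = r by omega] at t2
      exact t1.sub t2
    have hd := hh.totalDegree (by rw [k1]; exact mul_ne_zero hκ0 hL)
    rw [k1, totalDegree_mul_of_isDomain hκ0 hL, (Stmt8.isHomogeneous_L k r).totalDegree hL] at hd
    have hz : κ.totalDegree = 0 := by omega
    rw [totalDegree_eq_zero_iff_eq_C] at hz
    rw [hz]
    apply IsUnit.map
    rw [isUnit_iff_ne_zero]
    intro h0
    rw [h0, map_zero] at hz
    exact hκ0 hz
  refine ⟨c, f, hch, hfh, hc0, hf0, ?_, ?_⟩
  · intro d hdc hdf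
    have d0 : d ∣ X 0 ^ p := by
      rw [← hκu.dvd_mul_left, ← k2]
      exact dvd_sub (Dvd.dvd.mul_left hdc _) (Dvd.dvd.mul_left hdf _)
    have d1 : d ∣ X 1 ^ q := by
      rw [← hκu.dvd_mul_left, ← k3]
      exact dvd_sub (Dvd.dvd.mul_left hdf _) (Dvd.dvd.mul_left hdc _)
    exact (Stmt8.relPrime01 k).pow d0 d1
  · apply le_antisymm
    · intro h hh
      rw [Submodule.mem_colon_span_singleton, smul_eq_mul] at hh
      obtain ⟨A, B, e⟩ := Ideal.mem_span_pair.1 hh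
      obtain ⟨μ, m1, m2, m3⟩ := Stmt8.cross p q r e.symm e1
      obtain ⟨ν, n1, n2, n3⟩ := Stmt8.cross p q r e.symm e2
      obtain ⟨κ', hκ'⟩ := hκu.exists_left_inv
      have key : h * κ = c * ν - f * μ := by
        apply mul_left_cancel₀ (mul_ne_zero hL hL)
        linear_combination -((X 0 + X 1) ^ r * h) * k1 + ((X 0 + X 1) ^ r * c) * n1
          - ((X 0 + X 1) ^ r * f) * m1 - (A1 * B2 - A2 * B1) * e - (A * B2 - A2 * B) * e1
          + (A * B1 - A1 * B) * e2
      exact Ideal.mem_span_pair.2 ⟨κ' * ν, -(κ' * μ), by linear_combination h * hκ' - κ' * key⟩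
    · rw [Ideal.span_le]
      rintro x (rfl | rfl)
      · rw [SetLike.mem_coe, Submodule.mem_colon_span_singleton]; exact hcm
      · rw [SetLike.mem_coe, Submodule.mem_colon_span_singleton]; exact hfm
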